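/- arXiv:2302.10807 — 2 statements merged into one kernel-verified Lean document; each statement's English description precedes it below -/
import Mathlib

section
/- Let (M, d) be a metric space with a distinguished base point x₀, let X be a real normed space, let L ≥ 0, and let f : M → X be L-Lipschitz with f(x₀) = 0. Then for every n ∈ ℕ, all points x₁, …, xₙ ∈ M and all scalars α₁, …, αₙ ∈ ℝ, one has ‖Σ_{i=1}^n αᵢ f(xᵢ)‖ ≤ L · sup { |Σ_{i=1}^n αᵢ g(xᵢ)| : g : M → ℝ is 1-Lipschitz and g(x₀) = 0 }. -/
/-- Universal-property norm estimate for the Lipschitz free space: if `f : M → X` is an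
`L`-Lipschitz map from a pointed metric space into a normed space with `f x₀ = 0`, then for
any finite linear combination, `‖∑ αᵢ • f xᵢ‖` is at most `L` times the supremum of
`|∑ αᵢ g(xᵢ)|` over all `1`-Lipschitz `g : M → ℝ` vanishing at the base point. -/
theorem lipschitz_free_norm_bound {M : Type*} [MetricSpace M] (x₀ : M)
    {X : Type*} [NormedAddCommGroup X] [NormedSpace ℝ X]
    (L : ℝ) (hL : 0 ≤ L) (f : M → X)
    (hf : ∀ x y : M, dist (f x) (f y) ≤ L * dist x y) (hf0 : f x₀ = 0) :
    ∀ (n : ℕ) (x : Fin n → M) (α : Fin n → ℝ),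
      ‖∑ i, α i • f (x i)‖ ≤
        L * sSup {r : ℝ | ∃ g : M → ℝ, LipschitzWith 1 g ∧ g x₀ = 0 ∧
          r = |∑ i, α i * g (x i)|} := by
  intro n x α
  obtain ⟨φ, hφ, hφv⟩ := exists_dual_vector'' ℝ (∑ i, α i • f (x i))
  have hφv' : φ (∑ i, α i • f (x i)) = ‖∑ i, α i • f (x i)‖ := hφv
  rcases hL.eq_or_lt with h0 | hpos
  · have hz : ∀ y, f y = 0 := by
      intro y
      have h := hf y x₀
      rw [← h0, zero_mul, hf0] at h
      exact dist_le_zero.mp h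
    simp [hz, ← h0]
  have hbdd : BddAbove {r : ℝ | ∃ g : M → ℝ, LipschitzWith 1 g ∧ g x₀ = 0 ∧
          r = |∑ i, α i * g (x i)|} := by
    refine ⟨∑ i, |α i| * dist (x i) x₀, ?_⟩
    rintro r ⟨g, hg, hg0, rfl⟩
    refine (Finset.abs_sum_le_sum_abs _ _).trans (Finset.sum_le_sum fun i _ => ?_)
    rw [abs_mul]
    have h := hg.dist_le_mul (x i) x₀
    rw [hg0, Real.dist_eq, sub_zero, NNReal.coe_one, one_mul] at h
    exact mul_le_mul_of_nonneg_left h (abs_nonneg _)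
  have hmem : L⁻¹ * ‖∑ i, α i • f (x i)‖ ∈ {r : ℝ | ∃ g : M → ℝ, LipschitzWith 1 g ∧ g x₀ = 0 ∧
          r = |∑ i, α i * g (x i)|} := by
    refine ⟨fun y => L⁻¹ * φ (f y), ?_, by simp [hf0], ?_⟩
    · refine LipschitzWith.of_dist_le_mul fun y z => ?_
      rw [Real.dist_eq, ← mul_sub, ← map_sub, abs_mul, abs_of_pos (inv_pos.mpr hpos),
        NNReal.coe_one, one_mul, inv_mul_le_iff₀ hpos]
      have h1 : |φ (f y - f z)| ≤ 1 * ‖f y - f z‖ := φ.le_of_opNorm_le hφ _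
      rw [one_mul, ← dist_eq_norm] at h1
      exact h1.trans (hf y z)
    · have : ∑ i, α i * (L⁻¹ * φ (f (x i))) = L⁻¹ * ‖∑ i, α i • f (x i)‖ := by
        rw [← hφv', map_sum, Finset.mul_sum]
        refine Finset.sum_congr rfl fun i _ => ?_
        rw [map_smul, smul_eq_mul]
        ring
      rw [this, abs_of_nonneg (by positivity)]
  have := le_csSup hbdd hmem
  rwa [inv_mul_le_iff₀ hpos] at this
end

section
/- Let (M, d) be a metric space and let μ : M → ℝ be a finitely supported function with Σ_{x ∈ M} μ(x) = 0. Then sup { Σ_{x ∈ M} μ(x) g(x) : g : M → ℝ is 1-Lipschitz } = inf { Σ_{j=1}^n |αⱼ| d(yⱼ, zⱼ) : n ∈ ℕ, αⱼ ∈ ℝ, yⱼ, zⱼ ∈ M such that μ = Σ_{j=1}^n αⱼ (𝟙_{yⱼ} − 𝟙_{zⱼ}) }, where 𝟙_p denotes the indicator function of the point p. (This identifies the norm of ℱ(M) on finitely supported mass-zero elements with the Arens–Eells / transportation cost norm |||·|||.) -/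
def AERep {M : Type*} [MetricSpace M] (μ : M →₀ ℝ) (r : ℝ) : Prop :=
  ∃ (n : ℕ) (α : Fin n → ℝ) (y z : Fin n → M),
        μ = ∑ j, α j • (Finsupp.single (y j) (1 : ℝ) - Finsupp.single (z j) (1 : ℝ)) ∧
        r = ∑ j, |α j| * dist (y j) (z j)

section AE
variable {M : Type*} [MetricSpace M]

lemma AERep.zero : AERep (0 : M →₀ ℝ) 0 :=
  ⟨0, Fin.elim0, Fin.elim0, Fin.elim0, by simp, by simp⟩

lemma AERep.add {μ ν : M →₀ ℝ} {r s : ℝ} (h : AERep μ r) (k : AERep ν s) :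
    AERep (μ + ν) (r + s) := by
  obtain ⟨n, α, y, z, rfl, rfl⟩ := h
  obtain ⟨m, β, u, v, rfl, rfl⟩ := k
  refine ⟨n + m, Fin.append α β, Fin.append y u, Fin.append z v, ?_, ?_⟩ <;>
  simp [Fin.sum_univ_add]

lemma AERep.smul {μ : M →₀ ℝ} {r : ℝ} (c : ℝ) (hc : 0 ≤ c) (h : AERep μ r) :
    AERep (c • μ) (c * r) := by
  obtain ⟨n, α, y, z, rfl, rfl⟩ := h
  refine ⟨n, fun i => c * α i, y, z, ?_, ?_⟩
  · simp only [Finset.smul_sum, mul_smul]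
  · simp only [Finset.mul_sum, abs_mul, abs_of_nonneg hc, mul_assoc]

lemma AERep.pair (b : ℝ) (x y : M) :
    AERep (b • (Finsupp.single x (1 : ℝ) - Finsupp.single y (1 : ℝ))) (|b| * dist x y) :=
  ⟨1, fun _ => b, fun _ => x, fun _ => y, by simp, by simp⟩

lemma AERep.nonneg {μ : M →₀ ℝ} {r : ℝ} (h : AERep μ r) : 0 ≤ r := by
  obtain ⟨n, α, y, z, rfl, rfl⟩ := h
  positivity

lemma AERep.le {μ : M →₀ ℝ} {r : ℝ} (h : AERep μ r) (g : M → ℝ) (hg : LipschitzWith 1 g) :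
    (μ.sum fun x v => v * g x) ≤ r := by
  obtain ⟨n, α, y, z, rfl, rfl⟩ := h
  have key : ∀ ν : M →₀ ℝ, (ν.sum fun x v => v * g x) = Finsupp.linearCombination ℝ g ν := by
    intro ν
    simp [Finsupp.linearCombination_apply]
  rw [key, map_sum]
  refine Finset.sum_le_sum fun j _ => ?_
  rw [map_smul, map_sub]
  simp only [Finsupp.linearCombination_single, smul_eq_mul, one_mul]
  refine (le_abs_self _).trans ?_
  rw [abs_mul]
  have := hg.dist_le_mul (y j) (z j)
  rw [Real.dist_eq] at this
  simp only [NNReal.coe_one, one_mul] at this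
  gcongr

lemma AERep.mass {μ : M →₀ ℝ} {r : ℝ} (h : AERep μ r) :
    Finsupp.linearCombination ℝ (fun _ : M => (1 : ℝ)) μ = 0 := by
  obtain ⟨n, α, y, z, rfl, rfl⟩ := h
  simp

def AESet (p : M) (μ : M →₀ ℝ) : Set ℝ :=
  {r | ∃ c : ℝ, AERep (μ - c • Finsupp.single p (1 : ℝ)) r}

lemma AESet.nonempty (p : M) (μ : M →₀ ℝ) : (AESet p μ).Nonempty := by
  induction μ using Finsupp.induction_linear with
  | zero => exact ⟨0, 0, by simpa using AERep.zero⟩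
  | add f g hf hg =>
    obtain ⟨r, c, h⟩ := hf
    obtain ⟨s, d, k⟩ := hg
    refine ⟨r + s, c + d, ?_⟩
    convert h.add k using 1
    module
  | single a b =>
    refine ⟨|b| * dist a p, b, ?_⟩
    convert AERep.pair b a p using 1
    simp [smul_sub]

lemma AESet.bdd (p : M) (μ : M →₀ ℝ) : BddBelow (AESet p μ) :=
  ⟨0, fun _ ⟨_, h⟩ => h.nonneg⟩

noncomputable def AEN (p : M) (μ : M →₀ ℝ) : ℝ := sInf (AESet p μ)

lemma AEN.add_le (p : M) (μ ν : M →₀ ℝ) : AEN p (μ + ν) ≤ AEN p μ + AEN p ν := by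
  refine le_of_forall_pos_lt_add fun ε hε => ?_
  obtain ⟨r, ⟨c, h⟩, hr⟩ := exists_lt_of_csInf_lt (AESet.nonempty p μ)
    (lt_add_of_pos_right (AEN p μ) (half_pos hε))
  obtain ⟨s, ⟨d, k⟩, hs⟩ := exists_lt_of_csInf_lt (AESet.nonempty p ν)
    (lt_add_of_pos_right (AEN p ν) (half_pos hε))
  have : AEN p (μ + ν) ≤ r + s := by
    refine csInf_le (AESet.bdd _ _) ⟨c + d, ?_⟩
    convert h.add k using 1
    module
  linarith

lemma AEN.smul_le (p : M) (c : ℝ) (hc : 0 < c) (μ : M →₀ ℝ) :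
    AEN p (c • μ) ≤ c * AEN p μ := by
  rw [← div_le_iff₀' hc]
  refine le_csInf (AESet.nonempty p μ) ?_
  rintro r ⟨d, h⟩
  rw [div_le_iff₀' hc]
  refine csInf_le (AESet.bdd _ _) ⟨c * d, ?_⟩
  convert h.smul c hc.le using 1
  module

lemma AEN.smul (p : M) (c : ℝ) (hc : 0 < c) (μ : M →₀ ℝ) :
    AEN p (c • μ) = c * AEN p μ := by
  refine le_antisymm (AEN.smul_le p c hc μ) ?_
  have := AEN.smul_le p c⁻¹ (inv_pos.2 hc) (c • μ)
  rw [inv_smul_smul₀ hc.ne', ← div_eq_inv_mul, le_div_iff₀' hc] at this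
  exact this

lemma AEN.zero (p : M) : AEN p 0 = 0 := by
  have := AEN.smul p 2 (by norm_num) 0
  rw [smul_zero] at this
  linarith

lemma AEN.exists_g (p : M) (μ : M →₀ ℝ) (h0 : μ ≠ 0) :
    ∃ g : M → ℝ, LipschitzWith 1 g ∧ (μ.sum fun x v => v * g x) = AEN p μ := by
  obtain ⟨F, hF, hle⟩ := exists_extension_of_le_sublinear
    (LinearPMap.mkSpanSingleton (K := ℝ) μ (AEN p μ) h0) (AEN p)
    (fun c hc x => AEN.smul p c hc x) (AEN.add_le p) (by
      rintro ⟨x, hx⟩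
      obtain ⟨t, rfl⟩ := Submodule.mem_span_singleton.1 hx
      erw [LinearPMap.mkSpanSingleton'_apply]
      simp only [smul_eq_mul, RingHom.id_apply]
      rcases lt_trichotomy t 0 with ht | rfl | ht
      · have h1 := AEN.add_le p (t • μ) ((-t) • μ)
        rw [AEN.smul p (-t) (by linarith), ← add_smul, add_neg_cancel, zero_smul, AEN.zero] at h1
        linarith
      · simp [AEN.zero]
      · rw [AEN.smul p t ht])
  refine ⟨fun x => F (Finsupp.single x 1), ?_, ?_⟩
  · refine LipschitzWith.of_le_add fun x y => ?_
    have h1 := hle (Finsupp.single x 1 - Finsupp.single y 1)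
    have h2 : AEN p (Finsupp.single x 1 - Finsupp.single y 1) ≤ dist x y :=
      csInf_le (AESet.bdd _ _) ⟨0, by simpa using AERep.pair 1 x y⟩
    rw [map_sub] at h1
    linarith
  · have h1 := hF ⟨μ, Submodule.mem_span_singleton_self μ⟩
    have h2 := LinearPMap.mkSpanSingleton_apply ℝ ℝ (σ := RingHom.id ℝ) h0 (AEN p μ)
    have h3 : F μ = AEN p μ := h1.trans h2
    rw [← h3]
    conv_rhs => rw [← Finsupp.sum_single μ]
    rw [map_finsuppSum]
    refine Finsupp.sum_congr fun x _ => ?_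
    rw [← smul_eq_mul, ← map_smul]
    simp

end AE

/-- Arens–Eells / transportation cost duality: for a finitely supported `μ : M → ℝ` with
total mass zero, the supremum of `∑ μ(x) g(x)` over `1`-Lipschitz `g : M → ℝ` equals the
infimum of `∑ |αⱼ| d(yⱼ, zⱼ)` over all representations
`μ = ∑ αⱼ (𝟙_{yⱼ} − 𝟙_{zⱼ})`. -/
theorem arens_eells_duality {M : Type*} [MetricSpace M]
    (μ : M →₀ ℝ) (hμ : (μ.sum fun _ v => v) = 0) :
    sSup {r : ℝ | ∃ g : M → ℝ, LipschitzWith 1 g ∧ r = μ.sum fun x v => v * g x} =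
      sInf {r : ℝ | ∃ (n : ℕ) (α : Fin n → ℝ) (y z : Fin n → M),
        μ = ∑ j, α j • (Finsupp.single (y j) (1 : ℝ) - Finsupp.single (z j) (1 : ℝ)) ∧
        r = ∑ j, |α j| * dist (y j) (z j)} := by
  change _ = sInf {r : ℝ | AERep μ r}
  have hmass : Finsupp.linearCombination ℝ (fun _ : M => (1 : ℝ)) μ = 0 := by
    simpa [Finsupp.linearCombination_apply] using hμ
  obtain ⟨g, hg, hgr, hne⟩ : ∃ g : M → ℝ, LipschitzWith 1 g ∧
      sInf {r : ℝ | AERep μ r} ≤ (μ.sum fun x v => v * g x) ∧ {r : ℝ | AERep μ r}.Nonempty := by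
    by_cases h0 : μ = 0
    · subst h0
      refine ⟨fun _ => 0, LipschitzWith.const' 0, ?_, 0, AERep.zero⟩
      rw [Finsupp.sum_zero_index]
      exact csInf_le ⟨0, fun _ h => AERep.nonneg h⟩ AERep.zero
    · obtain ⟨p, -⟩ := Finsupp.ne_iff.1 h0
      have hset : AESet p μ = {r : ℝ | AERep μ r} := by
        ext r
        constructor
        · rintro ⟨c, h⟩
          have := h.mass
          rw [map_sub, hmass] at this
          have hc : c = 0 := by simpa using this
          subst hc
          simpa using h
        · intro h
          exact ⟨0, by simpa using h⟩
      obtain ⟨g, hg, h⟩ := AEN.exists_g p μ h0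
      refine ⟨g, hg, ?_, hset ▸ AESet.nonempty p μ⟩
      rw [h, AEN, hset]
  have hub : ∀ r ∈ {r : ℝ | ∃ g : M → ℝ, LipschitzWith 1 g ∧ r = μ.sum fun x v => v * g x},
      r ≤ sInf {r : ℝ | AERep μ r} := by
    rintro r ⟨g, hg, rfl⟩
    exact le_csInf hne fun s hs => AERep.le hs g hg
  refine le_antisymm (csSup_le ⟨_, g, hg, rfl⟩ hub) ?_
  exact hgr.trans (le_csSup ⟨_, hub⟩ ⟨g, hg, rfl⟩)
end
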